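/- Let H be a symmetric positive semidefinite real n × n matrix, M a real n × n matrix, Q = H M, and G = (Qᵀ + Q) − Mᵀ H M, and let c₀ > 0 satisfy xᵀ G x ≥ c₀ (Mx)ᵀ H (Mx) for all x ∈ ℝⁿ. Let (g^t)_{t≥0} and (g̃^t)_{t≥0} be sequences in ℝⁿ with g^{t+1} = g^t − M(g^t − g̃^t) for all t, let g* ∈ ℝⁿ satisfy (g* − g̃^t)ᵀ Q (g^t − g̃^t) ≤ 0 for all t, and suppose (g̃^t − g̃^{t+1})ᵀ Q [(g^t − g̃^t) − (g^{t+1} − g̃^{t+1})] ≥ 0 for all t. Then for every integer T ≥ 0: ‖g^T − g^{T+1}‖²_H ≤ ‖g^0 − g*‖²_H / (c₀ (T + 1)). -/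

import Mathlib

open Matrix

theorem Matrix.IsSymm.dotProduct_mulVec_comm {n R : Type*} [Fintype n] [CommSemiring R]
    {H : Matrix n n R} (hH : H.IsSymm) (x y : n → R) : x ⬝ᵥ H *ᵥ y = y ⬝ᵥ H *ᵥ x := by
  rw [dotProduct_mulVec, ← mulVec_transpose, hH.eq, dotProduct_comm]

theorem Matrix.IsSymm.dotProduct_mulVec_sub_self {n R : Type*} [Fintype n] [CommRing R]
    {H : Matrix n n R} (hH : H.IsSymm) (x y : n → R) :
    (x - y) ⬝ᵥ H *ᵥ (x - y) = x ⬝ᵥ H *ᵥ x - 2 * (x ⬝ᵥ H *ᵥ y) + y ⬝ᵥ H *ᵥ y := by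
  simp only [mulVec_sub, sub_dotProduct, dotProduct_sub, hH.dotProduct_mulVec_comm y x]
  ring

/-- The quadratic form of `(Qᵀ + Q) - Mᵀ H M` with `Q = H M`. -/
theorem Matrix.dotProduct_mulVec_correction {n R : Type*} [Fintype n] [CommRing R]
    (H M : Matrix n n R) (x : n → R) :
    x ⬝ᵥ (((H * M)ᵀ + H * M) - Mᵀ * H * M) *ᵥ x =
      2 * (x ⬝ᵥ H *ᵥ (M *ᵥ x)) - (M *ᵥ x) ⬝ᵥ H *ᵥ (M *ᵥ x) := by
  have h₁ : x ⬝ᵥ (H * M)ᵀ *ᵥ x = x ⬝ᵥ H *ᵥ (M *ᵥ x) := by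
    rw [mulVec_transpose, dotProduct_comm, ← dotProduct_mulVec, mulVec_mulVec]
  have h₂ : x ⬝ᵥ (Mᵀ * H * M) *ᵥ x = (M *ᵥ x) ⬝ᵥ H *ᵥ (M *ᵥ x) := by
    rw [← mulVec_mulVec, ← mulVec_mulVec, dotProduct_mulVec, vecMul_transpose]
  rw [sub_mulVec, add_mulVec, dotProduct_sub, dotProduct_add, h₁, h₂, ← mulVec_mulVec]
  ring

/-- If a nonincreasing sequence `a` is dominated by the decrements of a nonnegative sequence `b`,
then `a T ≤ b 0 / (c (T + 1))`. -/
theorem le_div_of_antitone_of_mul_le_sub {a b : ℕ → ℝ} {c : ℝ} (hc : 0 < c)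
    (ha : Antitone a) (hb : ∀ t, 0 ≤ b t) (hab : ∀ t, c * a t ≤ b t - b (t + 1)) (T : ℕ) :
    a T ≤ b 0 / (c * (T + 1)) := by
  have hsum : ∑ _t ∈ Finset.range (T + 1), c * a T ≤
      ∑ t ∈ Finset.range (T + 1), (b t - b (t + 1)) := by
    refine Finset.sum_le_sum fun t ht => le_trans ?_ (hab t)
    exact mul_le_mul_of_nonneg_left (ha (Finset.mem_range_succ_iff.mp ht)) hc.le
  rw [Finset.sum_range_sub', Finset.sum_const, Finset.card_range, nsmul_eq_mul] at hsum
  push_cast at hsum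
  rw [le_div_iff₀ (by positivity)]
  linarith [hb (T + 1)]

/-- Theorem 1 / Theorem B.3: worst-case `O(1/T)` non-ergodic convergence rate
for the abstract prediction–correction scheme. -/
theorem stmt_6 {n : ℕ} (H M : Matrix (Fin n) (Fin n) ℝ)
    (hH : H.PosSemidef)
    (Q G : Matrix (Fin n) (Fin n) ℝ) (hQ : Q = H * M)
    (hG : G = (Qᵀ + Q) - Mᵀ * H * M)
    (c₀ : ℝ) (hc₀ : 0 < c₀)
    (hGc : ∀ x : Fin n → ℝ,
      c₀ * ((M.mulVec x) ⬝ᵥ H.mulVec (M.mulVec x)) ≤ x ⬝ᵥ G.mulVec x)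
    (g gt : ℕ → Fin n → ℝ)
    (hrec : ∀ t : ℕ, g (t + 1) = g t - M.mulVec (g t - gt t))
    (gstar : Fin n → ℝ)
    (hvi : ∀ t : ℕ, (gstar - gt t) ⬝ᵥ Q.mulVec (g t - gt t) ≤ 0)
    (hmono : ∀ t : ℕ,
      0 ≤ (gt t - gt (t + 1)) ⬝ᵥ Q.mulVec ((g t - gt t) - (g (t + 1) - gt (t + 1)))) :
    ∀ T : ℕ,
      (g T - g (T + 1)) ⬝ᵥ H.mulVec (g T - g (T + 1)) ≤
        ((g 0 - gstar) ⬝ᵥ H.mulVec (g 0 - gstar)) / (c₀ * (T + 1)) := by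
  subst hQ hG
  have hS : H.IsSymm := by
    simpa [IsHermitian, IsSymm, conjTranspose_eq_transpose_of_trivial] using hH.isHermitian
  have hnn : ∀ x : Fin n → ℝ, 0 ≤ x ⬝ᵥ H *ᵥ x := fun x => by
    simpa using hH.dotProduct_mulVec_nonneg x
  have hstep : ∀ t, g t - g (t + 1) = M *ᵥ (g t - gt t) := fun t => by
    rw [hrec t, sub_sub_cancel]
  simp only [dotProduct_mulVec_correction] at hGc
  simp only [← mulVec_mulVec] at hvi hmono
  refine le_div_of_antitone_of_mul_le_sub
    (a := fun t => (g t - g (t + 1)) ⬝ᵥ H *ᵥ (g t - g (t + 1)))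
    (b := fun t => (g t - gstar) ⬝ᵥ H *ᵥ (g t - gstar)) hc₀
    (antitone_nat_of_succ_le fun t => ?_) (fun t => hnn _) (fun t => ?_)
  · have hm := hmono t
    have hdiff : gt t - gt (t + 1) =
        M *ᵥ (g t - gt t) - ((g t - gt t) - (g (t + 1) - gt (t + 1))) := by
      rw [← hstep t]; abel
    have hsucc : M *ᵥ (g (t + 1) - gt (t + 1)) =
        M *ᵥ (g t - gt t) - M *ᵥ ((g t - gt t) - (g (t + 1) - gt (t + 1))) := by
      rw [← mulVec_sub, sub_sub_cancel]
    rw [hdiff, sub_dotProduct] at hm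
    simp only [hstep]
    rw [hsucc, hS.dotProduct_mulVec_sub_self]
    have hG := hGc ((g t - gt t) - (g (t + 1) - gt (t + 1)))
    have hpos := mul_nonneg hc₀.le (hnn (M *ᵥ ((g t - gt t) - (g (t + 1) - gt (t + 1)))))
    linarith
  · have hv := hvi t
    have hdiff : gstar - gt t = (g t - gt t) - (g t - gstar) := by abel
    have hsucc : g (t + 1) - gstar = (g t - gstar) - M *ᵥ (g t - gt t) := by
      rw [hrec t]; abel
    rw [hdiff, sub_dotProduct] at hv
    simp only [hstep]
    rw [hsucc, hS.dotProduct_mulVec_sub_self (g t - gstar)]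
    linarith [hGc (g t - gt t)]
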